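/- Let d ≥ 1 and let v₀, v₁, …, v_d be affinely independent points of Euclidean space ℝ^d, with T the convex hull of {v₀, …, v_d}. Let x_T be a point in the interior of T, and let T_F be the convex hull of {v₁, …, v_d, x_T}. Let φ : ℝ^d → ℝ be an affine map with φ(x_T) = 1 and φ(v_i) = 0 for every i ∈ {1, …, d}. Then the linear part of φ applied to the vector x_T − v₀ equals −(|T| − |T_F|)/|T_F|, where |·| denotes Lebesgue volume; equivalently, the vector field x ↦ φ(x)·(x_T − v₀) has constant divergence −(|T| − |T_F|)/|T_F|. -/

import Mathlib

open MeasureTheory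

/-- Lebesgue volume scales under an affine map by the determinant of its linear part. -/
lemma volume_image_affineMap {E : Type*} [NormedAddCommGroup E] [InnerProductSpace ℝ E]
    [FiniteDimensional ℝ E] [MeasurableSpace E] [BorelSpace E] (g : E →ᵃ[ℝ] E) (s : Set E) :
    volume (g '' s) = ENNReal.ofReal |LinearMap.det g.linear| * volume s := by
  have h : g '' s = (fun y => g 0 + y) '' (g.linear '' s) := by
    rw [Set.image_image]
    refine Set.image_congr fun x _ => ?_
    rw [g.decomp]
    simp [add_comm]
  rw [h, Set.image_add_left, measure_preimage_add, Measure.addHaar_image_linearMap]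

/-- Let `T` be the simplex on affinely independent points `v₀, …, v_d` in `ℝ^d`, let
`x_T` be an interior point of `T` and `T_F` the simplex on `v₁, …, v_d, x_T`. If `φ` is
affine with `φ x_T = 1` and `φ v_i = 0` for `i ≠ 0`, then the linear part of `φ`
applied to `x_T - v₀` equals `-(|T| - |T_F|)/|T_F|`; i.e. the vector field
`x ↦ φ x • (x_T - v₀)` has constant divergence `-(|T| - |T_F|)/|T_F|`. -/
theorem stmt_4 (d : ℕ) (hd : 1 ≤ d)
    (v : Fin (d + 1) → EuclideanSpace ℝ (Fin d))
    (hv : AffineIndependent ℝ v)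
    (T : Set (EuclideanSpace ℝ (Fin d)))
    (hT : T = convexHull ℝ (Set.range v))
    (xT : EuclideanSpace ℝ (Fin d)) (hxT : xT ∈ interior T)
    (TF : Set (EuclideanSpace ℝ (Fin d)))
    (hTF : TF = convexHull ℝ ({xT} ∪ Set.range fun i : Fin d => v i.succ))
    (φ : EuclideanSpace ℝ (Fin d) →ᵃ[ℝ] ℝ)
    (hφx : φ xT = 1)
    (hφv : ∀ i : Fin (d + 1), i ≠ 0 → φ (v i) = 0) :
    φ.linear (xT - v 0) =
      -(((volume T).toReal - (volume TF).toReal) / (volume TF).toReal) := by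
  have hsub (x y : EuclideanSpace ℝ (Fin d)) : φ.linear (x - y) = φ x - φ y :=
    φ.linearMap_vsub x y
  -- the affine shear fixing the hyperplane `φ = 0` and moving `xT` to `v 0`
  let g : EuclideanSpace ℝ (Fin d) →ᵃ[ℝ] EuclideanSpace ℝ (Fin d) :=
    AffineMap.id ℝ _ + (LinearMap.toSpanSingleton ℝ _ (v 0 - xT)).toAffineMap.comp φ
  have hg (x) : g x = x + φ x • (v 0 - xT) := rfl
  have hlin : g.linear = LinearMap.transvection φ.linear (v 0 - xT) := by
    ext1 x
    rfl
  have hdet : LinearMap.det g.linear = φ (v 0) := by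
    rw [hlin, LinearMap.transvection.det, hsub, hφx]
    ring
  have himage : g '' TF = T := by
    rw [hTF, hT, g.image_convexHull, Set.image_union, Set.image_singleton, ← Set.range_comp,
      Fin.range_fin_succ, Set.insert_eq]
    congr 3
    · simp [hg, hφx]
    · ext1 i
      simp [hg, hφv i.succ (Fin.succ_ne_zero i), Fin.tail]
  have hpos : 0 < φ (v 0) := by
    by_contra! hle
    have hsubset : T ⊆ φ ⁻¹' Set.Iic 0 := by
      rw [hT]
      refine convexHull_min ?_ ((convex_Iic 0).affine_preimage φ)
      rintro _ ⟨i, rfl⟩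
      by_cases hi : i = 0
      · simpa [hi] using hle
      · simp [hφv i hi]
    have := hsubset (interior_subset hxT)
    norm_num [hφx] at this
  have hvol : (volume T).toReal = φ (v 0) * (volume TF).toReal := by
    rw [← himage, volume_image_affineMap, hdet, abs_of_pos hpos, ENNReal.toReal_mul,
      ENNReal.toReal_ofReal hpos.le]
  have hT_pos : 0 < (volume T).toReal := by
    refine ENNReal.toReal_pos (Measure.measure_pos_of_nonempty_interior _ ⟨xT, hxT⟩).ne' ?_
    rw [hT]
    exact ((Set.finite_range v).isCompact_convexHull ℝ).measure_ne_top
  have hTF_ne : (volume TF).toReal ≠ 0 := by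
    intro h
    simp [hvol, h] at hT_pos
  rw [hsub, hφx, hvol]
  field_simp
  ring
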